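/- arXiv:1903.11855 — 3 statements merged into one kernel-verified Lean document; each statement's English description precedes it below -/
import Mathlib

section
/- Let R be an s-unital (not necessarily unital) ring and let (P,Q,ψ) be an s-unital R-system satisfying Condition (FS). Let (S,T,σ,B) be a semi-full graded covariant representation of (P,Q,ψ) such that the ideal I^(k) of B₀ is s-unital for every k ≥ 0. Then B is nearly epsilon-strongly ℤ-graded: for every i ∈ ℤ and every x ∈ B_i there exist e ∈ B_i B_{-i} and f ∈ B_{-i} B_i with ex = x = xf. -/
set_option maxHeartbeats 800000

/-- For additive subgroups `X Y` of a (possibly non-unital) ring `B`, `sMul X Y` is the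
additive span of the set of products `x * y` with `x ∈ X`, `y ∈ Y`. -/
def sMul {B : Type*} [NonUnitalRing B] (X Y : AddSubgroup B) : AddSubgroup B :=
  AddSubgroup.closure {z : B | ∃ x ∈ X, ∃ y ∈ Y, z = x * y}

/-- The `n`-fold product `X ⋯ X` of an additive subgroup of a ring, defined for `n ≥ 1`
(the value at `0` is junk). -/
def sPow {B : Type*} [NonUnitalRing B] (X : AddSubgroup B) : ℕ → AddSubgroup B
  | 0 => ⊥
  | 1 => X
  | n + 2 => sMul (sPow X (n + 1)) X

/-- A ℤ-grading of a (possibly non-unital) ring `B`: an internal direct sum decomposition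
into additive subgroups with `B_i B_j ⊆ B_{i+j}`. -/
structure ZGrading (B : Type*) [NonUnitalRing B] where
  comp : ℤ → AddSubgroup B
  isInternal : DirectSum.IsInternal comp
  mul_mem : ∀ {i j : ℤ} {x y : B}, x ∈ comp i → y ∈ comp j → x * y ∈ comp (i + j)

/-- A bimodule action of a (possibly non-unital) ring `R` on an abelian group `M`. -/
structure BimodAction (R M : Type*) [NonUnitalRing R] [AddCommGroup M] where
  lsmul : R → M → M
  rsmul : M → R → M
  lsmul_add : ∀ (r : R) (m m' : M), lsmul r (m + m') = lsmul r m + lsmul r m'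
  add_lsmul : ∀ (r r' : R) (m : M), lsmul (r + r') m = lsmul r m + lsmul r' m
  rsmul_add : ∀ (m m' : M) (r : R), rsmul (m + m') r = rsmul m r + rsmul m' r
  add_rsmul : ∀ (m : M) (r r' : R), rsmul m (r + r') = rsmul m r + rsmul m r'
  mul_lsmul : ∀ (r r' : R) (m : M), lsmul (r * r') m = lsmul r (lsmul r' m)
  rsmul_mul : ∀ (m : M) (r r' : R), rsmul m (r * r') = rsmul (rsmul m r) r'
  lsmul_rsmul : ∀ (r : R) (m : M) (r' : R), rsmul (lsmul r m) r' = lsmul r (rsmul m r')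

/-- An `R`-system `(P, Q, ψ)`: `P` and `Q` are `R`-bimodules and
`ψ : P × Q → R` is biadditive and `R`-balanced/bilinear. -/
structure RSystem (R P Q : Type*) [NonUnitalRing R] [AddCommGroup P] [AddCommGroup Q] where
  actP : BimodAction R P
  actQ : BimodAction R Q
  psi : P → Q → R
  psi_add_left : ∀ (p p' : P) (q : Q), psi (p + p') q = psi p q + psi p' q
  psi_add_right : ∀ (p : P) (q q' : Q), psi p (q + q') = psi p q + psi p q'
  psi_lsmul : ∀ (r : R) (p : P) (q : Q), psi (actP.lsmul r p) q = r * psi p q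
  psi_rsmul : ∀ (p : P) (q : Q) (r : R), psi p (actQ.rsmul q r) = psi p q * r
  psi_mid : ∀ (p : P) (r : R) (q : Q), psi (actP.rsmul p r) q = psi p (actQ.lsmul r q)

/-- The `R`-system is unital: the bimodules `P` and `Q` are unital. -/
def RSystem.IsUnital {R P Q : Type*} [Ring R] [AddCommGroup P] [AddCommGroup Q]
    (sys : RSystem R P Q) : Prop :=
  (∀ p, sys.actP.lsmul 1 p = p) ∧ (∀ p, sys.actP.rsmul p 1 = p) ∧
    (∀ q, sys.actQ.lsmul 1 q = q) ∧ (∀ q, sys.actQ.rsmul q 1 = q)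

/-- An s-unital (possibly non-unital) ring. -/
def IsSUnitalRing (R : Type*) [NonUnitalRing R] : Prop :=
  ∀ r : R, (∃ u, u * r = r) ∧ (∃ v, r * v = r)

/-- The `R`-system is s-unital: `R` is s-unital and the bimodules `P`, `Q` are s-unital. -/
def RSystem.IsSUnital {R P Q : Type*} [NonUnitalRing R] [AddCommGroup P] [AddCommGroup Q]
    (sys : RSystem R P Q) : Prop :=
  IsSUnitalRing R ∧
    (∀ p : P, (∃ r, sys.actP.lsmul r p = p) ∧ (∃ r, sys.actP.rsmul p r = p)) ∧
    (∀ q : Q, (∃ r, sys.actQ.lsmul r q = q) ∧ (∃ r, sys.actQ.rsmul q r = q))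

/-- A covariant representation `(S, T, σ, B)` of an `R`-system `(P, Q, ψ)`. -/
structure CovRep {R P Q : Type*} [NonUnitalRing R] [AddCommGroup P] [AddCommGroup Q]
    (sys : RSystem R P Q) (B : Type*) [NonUnitalRing B] where
  S : P → B
  T : Q → B
  σ : R → B
  S_add : ∀ p p', S (p + p') = S p + S p'
  T_add : ∀ q q', T (q + q') = T q + T q'
  σ_add : ∀ r r', σ (r + r') = σ r + σ r'
  σ_mul : ∀ r r', σ (r * r') = σ r * σ r'
  S_rsmul : ∀ p r, S (sys.actP.rsmul p r) = S p * σ r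
  S_lsmul : ∀ r p, S (sys.actP.lsmul r p) = σ r * S p
  T_rsmul : ∀ q r, T (sys.actQ.rsmul q r) = T q * σ r
  T_lsmul : ∀ r q, T (sys.actQ.lsmul r q) = σ r * T q
  σ_psi : ∀ p q, σ (sys.psi p q) = S p * T q

/-- A graded covariant representation: a surjective covariant representation together with a
ℤ-grading of `B` such that `σ(R) ⊆ B₀`, `T(Q) ⊆ B₁` and `S(P) ⊆ B₋₁`. -/
structure GradedCovRep {R P Q : Type*} [NonUnitalRing R] [AddCommGroup P] [AddCommGroup Q]
    (sys : RSystem R P Q) (B : Type*) [NonUnitalRing B] extends CovRep sys B where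
  grading : ZGrading B
  surjective : NonUnitalSubring.closure (Set.range σ ∪ Set.range S ∪ Set.range T) = ⊤
  σ_mem : ∀ r, σ r ∈ grading.comp 0
  T_mem : ∀ q, T q ∈ grading.comp 1
  S_mem : ∀ p, S p ∈ grading.comp (-1)

/-- The operator `θ_{q,p} : Q → Q`, `x ↦ q · ψ(p, x)`. -/
def theta {R P Q : Type*} [NonUnitalRing R] [AddCommGroup P] [AddCommGroup Q]
    (sys : RSystem R P Q) (q : Q) (p : P) : Q → Q :=
  fun x => sys.actQ.rsmul q (sys.psi p x)

/-- The operator `θ_{p,q} : P → P`, `y ↦ ψ(y, q) · p`. -/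
def thetaOp {R P Q : Type*} [NonUnitalRing R] [AddCommGroup P] [AddCommGroup Q]
    (sys : RSystem R P Q) (p : P) (q : Q) : P → P :=
  fun y => sys.actP.lsmul (sys.psi y q) p

/-- `F_P(Q)`: the additive span of the operators `θ_{q,p}`. -/
def FPQ {R P Q : Type*} [NonUnitalRing R] [AddCommGroup P] [AddCommGroup Q]
    (sys : RSystem R P Q) : AddSubgroup (Q → Q) :=
  AddSubgroup.closure {f | ∃ q p, f = theta sys q p}

/-- `F_Q(P)`: the additive span of the operators `θ_{p,q}`. -/
def FQP {R P Q : Type*} [NonUnitalRing R] [AddCommGroup P] [AddCommGroup Q]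
    (sys : RSystem R P Q) : AddSubgroup (P → P) :=
  AddSubgroup.closure {f | ∃ p q, f = thetaOp sys p q}

/-- Condition (FS). -/
def CondFS {R P Q : Type*} [NonUnitalRing R] [AddCommGroup P] [AddCommGroup Q]
    (sys : RSystem R P Q) : Prop :=
  ∀ (qs : List Q) (ps : List P), ∃ Θ ∈ FPQ sys, ∃ Φ ∈ FQP sys,
    (∀ q ∈ qs, Θ q = q) ∧ (∀ p ∈ ps, Φ p = p)

/-- Condition (FS'): `id_Q ∈ F_P(Q)` and `id_P ∈ F_Q(P)`. -/
def CondFS' {R P Q : Type*} [NonUnitalRing R] [AddCommGroup P] [AddCommGroup Q]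
    (sys : RSystem R P Q) : Prop :=
  (id : Q → Q) ∈ FPQ sys ∧ (id : P → P) ∈ FQP sys

/-- `mulCont b [x₁,…,xₙ] = b * x₁ * ⋯ * xₙ` (left-associated product in a possibly
non-unital ring). -/
def mulCont {B : Type*} [NonUnitalRing B] : B → List B → B
  | b, [] => b
  | b, x :: xs => mulCont (b * x) xs

/-- The generating set of the ideal `I^(k)` of `B₀`: for `k ≥ 1` the set of products
`S(p₁)⋯S(pₖ) T(q₁)⋯T(qₖ)`, and for `k = 0` the set `{σ(r r') : r, r' ∈ R}`. -/
def genSet {R P Q B : Type*} [NonUnitalRing R] [AddCommGroup P] [AddCommGroup Q]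
    [NonUnitalRing B] {sys : RSystem R P Q} (rep : CovRep sys B) : ℕ → Set B
  | 0 => {b | ∃ r r' : R, b = rep.σ (r * r')}
  | k + 1 => {b | ∃ (p : P) (ps : List P) (q : Q) (qs : List Q),
      ps.length = k ∧ qs.length = k ∧
      b = mulCont (rep.S p) (ps.map rep.S) * mulCont (rep.T q) (qs.map rep.T)}

/-- The two-sided ideal of `B₀` generated by a subset `X ⊆ B₀`. -/
def idealGen {B : Type*} [NonUnitalRing B] (B0 : AddSubgroup B) (X : Set B) : AddSubgroup B :=
  sInf {I : AddSubgroup B | X ⊆ I ∧ I ≤ B0 ∧ ∀ a ∈ B0, ∀ x ∈ I, a * x ∈ I ∧ x * a ∈ I}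

/-- The ideal `I^(k)` of `B₀` associated to a covariant representation. -/
def idealI {R P Q B : Type*} [NonUnitalRing R] [AddCommGroup P] [AddCommGroup Q]
    [NonUnitalRing B] {sys : RSystem R P Q} (rep : GradedCovRep sys B) (k : ℕ) :
    AddSubgroup B :=
  idealGen (rep.grading.comp 0) (genSet rep.toCovRep k)

/-- A graded covariant representation is semi-full if `B_{-k} B_k = I^(k)` for every `k ≥ 0`. -/
def SemiFull {R P Q B : Type*} [NonUnitalRing R] [AddCommGroup P] [AddCommGroup Q]
    [NonUnitalRing B] {sys : RSystem R P Q} (rep : GradedCovRep sys B) : Prop :=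
  ∀ k : ℕ, sMul (rep.grading.comp (-(k : ℤ))) (rep.grading.comp (k : ℤ)) = idealI rep k

section Auxiliary

theorem exists_list_map_eq {α β : Type*} {g : α → β} {l : List β}
    (hl : ∀ b ∈ l, b ∈ Set.range g) : ∃ as : List α, as.map g = l := by
  have h : l ∈ Set.range (List.map g) := by
    rw [Set.range_list_map]
    exact hl
  exact h

variable {R P Q B : Type*} [NonUnitalRing R] [AddCommGroup P] [AddCommGroup Q] [NonUnitalRing B]

theorem mul_mem_sMul {X Y : AddSubgroup B} {x y : B} (hx : x ∈ X) (hy : y ∈ Y) :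
    x * y ∈ sMul X Y :=
  AddSubgroup.subset_closure ⟨x, hx, y, hy, rfl⟩

namespace ZGrading

variable (G : ZGrading B)

theorem mul_mem_of_eq {i j k : ℤ} {x y : B} (hx : x ∈ G.comp i) (hy : y ∈ G.comp j)
    (h : i + j = k) : x * y ∈ G.comp k :=
  h ▸ G.mul_mem hx hy

/-- Sandwiching an element of `B_m B_l` between homogeneous elements of degrees `i` and `j`. -/
theorem mul_mul_mem_sMul {i j m l m' l' : ℤ} {a b e : B} (ha : a ∈ G.comp i)
    (hb : b ∈ G.comp j) (he : e ∈ sMul (G.comp m) (G.comp l)) (hm : i + m = m')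
    (hl : l + j = l') : a * e * b ∈ sMul (G.comp m') (G.comp l') := by
  induction he using AddSubgroup.closure_induction with
  | mem z hz =>
    obtain ⟨x, hx, y, hy, rfl⟩ := hz
    have h : a * (x * y) * b = (a * x) * (y * b) := by simp only [mul_assoc]
    rw [h]
    exact mul_mem_sMul (G.mul_mem_of_eq ha hx hm) (G.mul_mem_of_eq hy hb hl)
  | zero => simp
  | add x y _ _ hx hy =>
    rw [mul_add, add_mul]
    exact add_mem hx hy
  | neg x _ hx =>
    rw [mul_neg, neg_mul]
    exact neg_mem hx

theorem sMul_le (i j : ℤ) : sMul (G.comp i) (G.comp j) ≤ G.comp (i + j) := by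
  refine (AddSubgroup.closure_le _).2 ?_
  rintro _ ⟨x, hx, y, hy, rfl⟩
  exact G.mul_mem hx hy

/-- `B_i B_{-i}` is closed under multiplication. -/
theorem sMul_neg_mul_mem {i j : ℤ} (hij : i + j = 0) {x y : B}
    (hx : x ∈ sMul (G.comp i) (G.comp j)) (hy : y ∈ sMul (G.comp i) (G.comp j)) :
    x * y ∈ sMul (G.comp i) (G.comp j) := by
  have hx0 : x ∈ G.comp 0 := hij ▸ G.sMul_le i j hx
  induction hy using AddSubgroup.closure_induction with
  | mem z hz =>
    obtain ⟨a, ha, b, hb, rfl⟩ := hz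
    rw [← mul_assoc]
    exact mul_mem_sMul (G.mul_mem_of_eq hx0 ha (zero_add i)) hb
  | zero => simp
  | add a b _ _ ha hb =>
    rw [mul_add]
    exact add_mem ha hb
  | neg a _ ha =>
    rw [mul_neg]
    exact neg_mem ha

/-- Additive subgroups of the homogeneous components which together span `B` are the whole
components. -/
theorem comp_le_of_iSup_eq_top {D : ℤ → AddSubgroup B} (hD : ∀ k, D k ≤ G.comp k)
    (htop : ⨆ k, D k = ⊤) (k : ℤ) : G.comp k ≤ D k := by
  intro x hx
  have hmem : x ∈ D k ⊔ ⨆ (j) (_ : j ≠ k), D j := by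
    have h : ⨆ j, D j ≤ D k ⊔ ⨆ (j) (_ : j ≠ k), D j := by
      refine iSup_le fun j => ?_
      by_cases hj : j = k
      · subst hj
        exact le_sup_left
      · exact le_sup_of_le_right (le_iSup₂_of_le j hj le_rfl)
    exact h (htop ▸ AddSubgroup.mem_top x)
  obtain ⟨d, hd, d', hd', rfl⟩ := AddSubgroup.mem_sup.1 hmem
  have h1 : d' ∈ G.comp k := by
    have h := sub_mem hx (hD k hd)
    rwa [add_sub_cancel_left] at h
  have h2 : d' ∈ ⨆ (j) (_ : j ≠ k), G.comp j :=
    iSup₂_mono (fun j _ => hD j) hd'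
  have h3 : d' = 0 :=
    AddSubgroup.disjoint_def.1 (G.isInternal.addSubgroup_iSupIndep k) h1 h2
  rw [h3, add_zero]
  exact hd

end ZGrading

/-- In an s-unital additive subgroup closed under multiplication, finitely many elements have
a common right unit. -/
theorem exists_common_right_unit {J : AddSubgroup B} (hmul : ∀ x ∈ J, ∀ y ∈ J, x * y ∈ J)
    (hJ : ∀ x ∈ J, ∃ f ∈ J, x * f = x) (ys : List B) (hys : ∀ y ∈ ys, y ∈ J) :
    ∃ f ∈ J, ∀ y ∈ ys, y * f = y := by
  induction ys with
  | nil => exact ⟨0, zero_mem J, by simp⟩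
  | cons a l ih =>
    obtain ⟨f, hf, hfl⟩ := ih fun y hy => hys y (List.mem_cons_of_mem _ hy)
    have ha : a ∈ J := hys a List.mem_cons_self
    obtain ⟨g, hg, hga⟩ := hJ (a - a * f) (sub_mem ha (hmul a ha f hf))
    refine ⟨f + (g - f * g), add_mem hf (sub_mem hg (hmul f hf g hg)), ?_⟩
    have key (y : B) : y * (f + (g - f * g)) = y * f + (y - y * f) * g := by
      simp only [mul_add, mul_sub, sub_mul, mul_assoc]
    intro y hy
    rw [key]
    rcases List.mem_cons.1 hy with rfl | hy
    · rw [hga, add_sub_cancel]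
    · rw [hfl y hy, sub_self, zero_mul, add_zero]

/-- In an s-unital additive subgroup closed under multiplication, finitely many elements have
a common left unit. -/
theorem exists_common_left_unit {J : AddSubgroup B} (hmul : ∀ x ∈ J, ∀ y ∈ J, x * y ∈ J)
    (hJ : ∀ x ∈ J, ∃ e ∈ J, e * x = x) (ys : List B) (hys : ∀ y ∈ ys, y ∈ J) :
    ∃ e ∈ J, ∀ y ∈ ys, e * y = y := by
  induction ys with
  | nil => exact ⟨0, zero_mem J, by simp⟩
  | cons a l ih =>
    obtain ⟨f, hf, hfl⟩ := ih fun y hy => hys y (List.mem_cons_of_mem _ hy)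
    have ha : a ∈ J := hys a List.mem_cons_self
    obtain ⟨g, hg, hga⟩ := hJ (a - f * a) (sub_mem ha (hmul f hf a ha))
    refine ⟨f + (g - g * f), add_mem hf (sub_mem hg (hmul g hg f hf)), ?_⟩
    have key (y : B) : (f + (g - g * f)) * y = f * y + g * (y - f * y) := by
      simp only [add_mul, mul_sub, sub_mul, mul_assoc]
    intro y hy
    rw [key]
    rcases List.mem_cons.1 hy with rfl | hy
    · rw [hga, add_sub_cancel]
    · rw [hfl y hy, sub_self, mul_zero, add_zero]

/-- An element of the additive span of the products `a * y` with `a ∈ X`, `y ∈ Y` is fixed by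
every common right unit of some finite family in `Y`. -/
theorem exists_list_right_unit {X : Set B} {Y : Set B} {z : B}
    (hz : z ∈ AddSubgroup.closure {z : B | ∃ x ∈ X, ∃ y ∈ Y, z = x * y}) :
    ∃ ys : List B, (∀ y ∈ ys, y ∈ Y) ∧ ∀ f : B, (∀ y ∈ ys, y * f = y) → z * f = z := by
  induction hz using AddSubgroup.closure_induction with
  | mem z hz =>
    obtain ⟨x, hx, y, hy, rfl⟩ := hz
    refine ⟨[y], by simpa using hy, fun f hf => ?_⟩
    rw [mul_assoc, hf y (by simp)]
  | zero => exact ⟨[], by simp, by simp⟩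
  | add a b _ _ ha hb =>
    obtain ⟨l, hl, hl'⟩ := ha
    obtain ⟨m, hm, hm'⟩ := hb
    refine ⟨l ++ m, ?_, fun f hf => ?_⟩
    · intro y hy
      exact (List.mem_append.1 hy).elim (hl y) (hm y)
    · rw [add_mul, hl' f fun y hy => hf y (List.mem_append_left _ hy),
        hm' f fun y hy => hf y (List.mem_append_right _ hy)]
  | neg a _ ha =>
    obtain ⟨l, hl, hl'⟩ := ha
    exact ⟨l, hl, fun f hf => by rw [neg_mul, hl' f hf]⟩

/-- An element of the additive span of the products `x * y` with `x ∈ X`, `y ∈ Y` is fixed by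
every common left unit of some finite family in `X`. -/
theorem exists_list_left_unit {X : Set B} {Y : Set B} {z : B}
    (hz : z ∈ AddSubgroup.closure {z : B | ∃ x ∈ X, ∃ y ∈ Y, z = x * y}) :
    ∃ xs : List B, (∀ x ∈ xs, x ∈ X) ∧ ∀ e : B, (∀ x ∈ xs, e * x = x) → e * z = z := by
  induction hz using AddSubgroup.closure_induction with
  | mem z hz =>
    obtain ⟨x, hx, y, hy, rfl⟩ := hz
    refine ⟨[x], by simpa using hx, fun f hf => ?_⟩
    rw [← mul_assoc, hf x (by simp)]
  | zero => exact ⟨[], by simp, by simp⟩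
  | add a b _ _ ha hb =>
    obtain ⟨l, hl, hl'⟩ := ha
    obtain ⟨m, hm, hm'⟩ := hb
    refine ⟨l ++ m, ?_, fun f hf => ?_⟩
    · intro y hy
      exact (List.mem_append.1 hy).elim (hl y) (hm y)
    · rw [mul_add, hl' f fun y hy => hf y (List.mem_append_left _ hy),
        hm' f fun y hy => hf y (List.mem_append_right _ hy)]
  | neg a _ ha =>
    obtain ⟨l, hl, hl'⟩ := ha
    exact ⟨l, hl, fun f hf => by rw [mul_neg, hl' f hf]⟩

theorem exists_list_right_unit_of_mem_sMul {X Y : AddSubgroup B} {z : B} (hz : z ∈ sMul X Y) :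
    ∃ ys : List B, (∀ y ∈ ys, y ∈ Y) ∧ ∀ f : B, (∀ y ∈ ys, y * f = y) → z * f = z :=
  have h : z ∈ AddSubgroup.closure
      {z : B | ∃ x ∈ (X : Set B), ∃ y ∈ (Y : Set B), z = x * y} :=
    AddSubgroup.closure_mono (fun _ ha => ha) hz
  exists_list_right_unit h

theorem exists_list_left_unit_of_mem_sMul {X Y : AddSubgroup B} {z : B} (hz : z ∈ sMul X Y) :
    ∃ xs : List B, (∀ x ∈ xs, x ∈ X) ∧ ∀ e : B, (∀ x ∈ xs, e * x = x) → e * z = z :=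
  have h : z ∈ AddSubgroup.closure
      {z : B | ∃ x ∈ (X : Set B), ∃ y ∈ (Y : Set B), z = x * y} :=
    AddSubgroup.closure_mono (fun _ ha => ha) hz
  exists_list_left_unit h

variable {sys : RSystem R P Q}

namespace CovRep

variable (rep : CovRep sys B)

/-- The words `σ(r) S(p₁) ⋯ S(pₙ)`. -/
inductive IsSWord : ℕ → B → Prop
  | sigma (r : R) : IsSWord 0 (rep.σ r)
  | mul_S {n : ℕ} {w : B} (p : P) : IsSWord n w → IsSWord (n + 1) (w * rep.S p)

/-- The words `T(q₁) ⋯ T(qₘ) σ(r) S(p₁) ⋯ S(pₙ)`, indexed by their degree `m - n`. -/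
inductive IsWord : ℤ → B → Prop
  | of_isSWord {n : ℕ} {w : B} : IsSWord rep n w → IsWord (-(n : ℤ)) w
  | T_mul {k : ℤ} {w : B} (q : Q) : IsWord k w → IsWord (k + 1) (rep.T q * w)

variable {rep}

theorem IsSWord.sigma_mul {n : ℕ} {w : B} (h : IsSWord rep n w) (r : R) :
    IsSWord rep n (rep.σ r * w) := by
  induction h with
  | sigma r' =>
    rw [← rep.σ_mul]
    exact .sigma _
  | mul_S p _ ih =>
    rw [← mul_assoc]
    exact .mul_S p ih

theorem IsSWord.S_mul (hsu : sys.IsSUnital) {n : ℕ} {w : B} (h : IsSWord rep n w) (p : P) :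
    IsSWord rep (n + 1) (rep.S p * w) := by
  induction h with
  | sigma r =>
    obtain ⟨u, hu⟩ := (hsu.2.1 (sys.actP.rsmul p r)).1
    rw [← rep.S_rsmul, ← hu, rep.S_lsmul]
    exact .mul_S _ (.sigma u)
  | mul_S p' _ ih =>
    rw [← mul_assoc]
    exact .mul_S p' ih

theorem IsSWord.exists_sigma_mul_eq (hsu : sys.IsSUnital) {n : ℕ} {w : B}
    (h : IsSWord rep n w) : ∃ r, rep.σ r * w = w := by
  induction h with
  | sigma r =>
    obtain ⟨u, hu⟩ := (hsu.1 r).1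
    exact ⟨u, by rw [← rep.σ_mul, hu]⟩
  | mul_S p _ ih =>
    obtain ⟨u, hu⟩ := ih
    exact ⟨u, by rw [← mul_assoc, hu]⟩

theorem IsWord.sigma_mul {k : ℤ} {w : B} (h : IsWord rep k w) (r : R) :
    IsWord rep k (rep.σ r * w) := by
  cases h with
  | of_isSWord h => exact .of_isSWord (h.sigma_mul r)
  | T_mul q h =>
    rw [← mul_assoc, ← rep.T_lsmul]
    exact .T_mul _ h

theorem IsWord.S_mul (hsu : sys.IsSUnital) {k : ℤ} {w : B} (h : IsWord rep k w) (p : P) :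
    IsWord rep (k - 1) (rep.S p * w) := by
  cases h with
  | @of_isSWord n w h =>
    have h' := IsWord.of_isSWord (h.S_mul hsu p)
    rwa [Nat.cast_add, Nat.cast_one, neg_add] at h'
  | T_mul q h =>
    rw [← mul_assoc, ← rep.σ_psi, add_sub_cancel_right]
    exact h.sigma_mul _

theorem IsWord.exists_sigma_mul_eq (hsu : sys.IsSUnital) {k : ℤ} {w : B}
    (h : IsWord rep k w) : ∃ r, rep.σ r * w = w := by
  cases h with
  | of_isSWord h => exact h.exists_sigma_mul_eq hsu
  | T_mul q h =>
    obtain ⟨u, hu⟩ := (hsu.2.2 q).1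
    exact ⟨u, by rw [← mul_assoc, ← rep.T_lsmul, hu]⟩

theorem IsWord.exists_eq_T_mul {k : ℤ} {w : B} (h : IsWord rep k w) (hk : 0 < k) :
    ∃ q y, w = rep.T q * y := by
  cases h with
  | of_isSWord h => omega
  | T_mul q h => exact ⟨q, _, rfl⟩

theorem IsWord.exists_eq_mul_S {k : ℤ} {w : B} (h : IsWord rep k w) (hk : k < 0) :
    ∃ y p, w = y * rep.S p := by
  induction h with
  | of_isSWord h =>
    cases h with
    | sigma r => simp at hk
    | mul_S p h => exact ⟨_, p, rfl⟩
  | T_mul q _ ih =>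
    obtain ⟨y, p, rfl⟩ := ih (by omega)
    exact ⟨rep.T q * y, p, (mul_assoc _ _ _).symm⟩

variable (rep)

theorem S_zero : rep.S 0 = 0 := by simpa using rep.S_add 0 0

theorem T_zero : rep.T 0 = 0 := by simpa using rep.T_add 0 0

theorem S_neg (p : P) : rep.S (-p) = -rep.S p := by
  have h := rep.S_add (-p) p
  rw [neg_add_cancel, rep.S_zero] at h
  exact eq_neg_of_add_eq_zero_left h.symm

theorem T_neg (q : Q) : rep.T (-q) = -rep.T q := by
  have h := rep.T_add (-q) q
  rw [neg_add_cancel, rep.T_zero] at h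
  exact eq_neg_of_add_eq_zero_left h.symm

/-- The additive span of the products `T(q) S(p)`. -/
def spanTS : AddSubgroup B := AddSubgroup.closure {z | ∃ q p, z = rep.T q * rep.S p}

theorem exists_spanTS_mul_T {Θ : Q → Q} (hΘ : Θ ∈ FPQ sys) :
    ∃ e ∈ rep.spanTS, ∀ q, e * rep.T q = rep.T (Θ q) := by
  induction hΘ using AddSubgroup.closure_induction with
  | mem f hf =>
    obtain ⟨q, p, rfl⟩ := hf
    refine ⟨_, AddSubgroup.subset_closure ⟨q, p, rfl⟩, fun x => ?_⟩
    rw [mul_assoc, ← rep.σ_psi, ← rep.T_rsmul, theta]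
  | zero => exact ⟨0, zero_mem _, fun q => by simp [rep.T_zero]⟩
  | add f g _ _ hf hg =>
    obtain ⟨a, ha, ha'⟩ := hf
    obtain ⟨b, hb, hb'⟩ := hg
    exact ⟨a + b, add_mem ha hb, fun q => by
      rw [add_mul, ha', hb', Pi.add_apply, rep.T_add]⟩
  | neg f _ hf =>
    obtain ⟨a, ha, ha'⟩ := hf
    exact ⟨-a, neg_mem ha, fun q => by rw [neg_mul, ha', Pi.neg_apply, rep.T_neg]⟩

theorem exists_spanTS_S_mul {Φ : P → P} (hΦ : Φ ∈ FQP sys) :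
    ∃ e ∈ rep.spanTS, ∀ p, rep.S p * e = rep.S (Φ p) := by
  induction hΦ using AddSubgroup.closure_induction with
  | mem f hf =>
    obtain ⟨p, q, rfl⟩ := hf
    refine ⟨_, AddSubgroup.subset_closure ⟨q, p, rfl⟩, fun x => ?_⟩
    rw [← mul_assoc, ← rep.σ_psi, ← rep.S_lsmul, thetaOp]
  | zero => exact ⟨0, zero_mem _, fun q => by simp [rep.S_zero]⟩
  | add f g _ _ hf hg =>
    obtain ⟨a, ha, ha'⟩ := hf
    obtain ⟨b, hb, hb'⟩ := hg
    exact ⟨a + b, add_mem ha hb, fun q => by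
      rw [mul_add, ha', hb', Pi.add_apply, rep.S_add]⟩
  | neg f _ hf =>
    obtain ⟨a, ha, ha'⟩ := hf
    exact ⟨-a, neg_mem ha, fun q => by rw [mul_neg, ha', Pi.neg_apply, rep.S_neg]⟩

/-- Condition (FS) gives left units in the span of `T(Q) S(P)` for the elements of
`T(Q) B`. -/
theorem exists_spanTS_left_unit (hfs : CondFS sys) {x : B}
    (hx : x ∈ AddSubgroup.closure
      {z : B | ∃ a ∈ Set.range rep.T, ∃ b ∈ (Set.univ : Set B), z = a * b}) :
    ∃ e ∈ rep.spanTS, e * x = x := by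
  obtain ⟨l, hl, hl'⟩ := exists_list_left_unit hx
  obtain ⟨qs, rfl⟩ := exists_list_map_eq hl
  obtain ⟨Θ, hΘ, -, -, hq, -⟩ := hfs qs []
  obtain ⟨e, he, he'⟩ := rep.exists_spanTS_mul_T hΘ
  refine ⟨e, he, hl' e fun b hb => ?_⟩
  obtain ⟨q, hqs, rfl⟩ := List.mem_map.1 hb
  rw [he', hq q hqs]

/-- Condition (FS) gives right units in the span of `T(Q) S(P)` for the elements of
`B S(P)`. -/
theorem exists_spanTS_right_unit (hfs : CondFS sys) {x : B}
    (hx : x ∈ AddSubgroup.closure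
      {z : B | ∃ a ∈ (Set.univ : Set B), ∃ b ∈ Set.range rep.S, z = a * b}) :
    ∃ e ∈ rep.spanTS, x * e = x := by
  obtain ⟨l, hl, hl'⟩ := exists_list_right_unit hx
  obtain ⟨ps, rfl⟩ := exists_list_map_eq hl
  obtain ⟨-, -, Φ, hΦ, -, hp⟩ := hfs [] ps
  obtain ⟨e, he, he'⟩ := rep.exists_spanTS_S_mul hΦ
  refine ⟨e, he, hl' e fun b hb => ?_⟩
  obtain ⟨p, hps, rfl⟩ := List.mem_map.1 hb
  rw [he', hp p hps]

end CovRep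

namespace GradedCovRep

variable (rep : GradedCovRep sys B)

theorem mem_comp_of_isSWord {n : ℕ} {w : B} (h : CovRep.IsSWord rep.toCovRep n w) :
    w ∈ rep.grading.comp (-(n : ℤ)) := by
  induction h with
  | sigma r => simpa using rep.σ_mem r
  | mul_S p _ ih => exact rep.grading.mul_mem_of_eq ih (rep.S_mem p) (by push_cast; ring)

theorem mem_comp_of_isWord {k : ℤ} {w : B} (h : CovRep.IsWord rep.toCovRep k w) :
    w ∈ rep.grading.comp k := by
  induction h with
  | of_isSWord h => exact rep.mem_comp_of_isSWord h
  | T_mul q _ ih => exact rep.grading.mul_mem_of_eq (rep.T_mem q) ih (by ring)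

theorem iSup_closure_isWord_eq_top (hsu : sys.IsSUnital) :
    ⨆ k, AddSubgroup.closure {w | CovRep.IsWord rep.toCovRep k w} = ⊤ := by
  rw [← AddSubgroup.closure_iUnion]
  set D := AddSubgroup.closure (⋃ k, {w | CovRep.IsWord rep.toCovRep k w})
  have of_word {k : ℤ} {w : B} (h : CovRep.IsWord rep.toCovRep k w) : w ∈ D :=
    AddSubgroup.subset_closure (Set.mem_iUnion.2 ⟨k, h⟩)
  have mul_of {b : B} (hb : ∀ k w, CovRep.IsWord rep.toCovRep k w → b * w ∈ D) :
      ∀ d ∈ D, b * d ∈ D := by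
    intro d hd
    induction hd using AddSubgroup.closure_induction with
    | mem w hw =>
      obtain ⟨k, hk⟩ := Set.mem_iUnion.1 hw
      exact hb k w hk
    | zero => simp
    | add x y _ _ hx hy =>
      rw [mul_add]
      exact add_mem hx hy
    | neg x _ hx =>
      rw [mul_neg]
      exact neg_mem hx
  have key (x : B) (hx : x ∈ NonUnitalSubring.closure
      (Set.range rep.σ ∪ Set.range rep.S ∪ Set.range rep.T)) :
      x ∈ D ∧ ∀ d ∈ D, x * d ∈ D := by
    induction hx using NonUnitalSubring.closure_induction with
    | mem x hx =>
      rcases hx with (⟨r, rfl⟩ | ⟨p, rfl⟩) | ⟨q, rfl⟩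
      · exact ⟨of_word (.of_isSWord (.sigma r)), mul_of fun k w hw => of_word (hw.sigma_mul r)⟩
      · refine ⟨?_, mul_of fun k w hw => of_word (hw.S_mul hsu p)⟩
        obtain ⟨u, hu⟩ := (hsu.2.1 p).1
        rw [← hu, rep.S_lsmul]
        exact of_word (.of_isSWord (.mul_S p (.sigma u)))
      · refine ⟨?_, mul_of fun k w hw => of_word (.T_mul q hw)⟩
        obtain ⟨u, hu⟩ := (hsu.2.2 q).2
        rw [← hu, rep.T_rsmul]
        exact of_word (.T_mul q (.of_isSWord (.sigma u)))
    | zero => exact ⟨zero_mem D, by simp⟩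
    | add x y _ _ hx hy =>
      refine ⟨add_mem hx.1 hy.1, fun d hd => ?_⟩
      rw [add_mul]
      exact add_mem (hx.2 d hd) (hy.2 d hd)
    | neg x _ hx =>
      refine ⟨neg_mem hx.1, fun d hd => ?_⟩
      rw [neg_mul]
      exact neg_mem (hx.2 d hd)
    | mul x y _ _ hx hy =>
      refine ⟨hx.2 y hy.1, fun d hd => ?_⟩
      rw [mul_assoc]
      exact hx.2 _ (hy.2 d hd)
  refine eq_top_iff.2 fun x _ => (key x ?_).1
  rw [rep.surjective]
  trivial

/-- Each homogeneous component is spanned by the words of its degree. -/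
theorem comp_le_closure_isWord (hsu : sys.IsSUnital) (k : ℤ) :
    rep.grading.comp k ≤ AddSubgroup.closure {w | CovRep.IsWord rep.toCovRep k w} :=
  rep.grading.comp_le_of_iSup_eq_top
    (fun _ => (AddSubgroup.closure_le _).2 fun _ hw => rep.mem_comp_of_isWord hw)
    (rep.iSup_closure_isWord_eq_top hsu) k

theorem comp_zero_le_sMul (hsu : sys.IsSUnital) :
    rep.grading.comp 0 ≤ sMul (rep.grading.comp 0) (rep.grading.comp 0) := by
  refine (rep.comp_le_closure_isWord hsu 0).trans ((AddSubgroup.closure_le _).2 fun w hw => ?_)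
  obtain ⟨r, hr⟩ := CovRep.IsWord.exists_sigma_mul_eq hsu hw
  rw [← hr]
  exact mul_mem_sMul (rep.σ_mem r) (rep.mem_comp_of_isWord hw)

/-- If `e` lies in the span of `T(Q) S(P)` and every `S(p) x` has a left unit in
`B_n B_{-n}`, then `e x` is `e' x` for some `e'` in `B_{n+1} B_{-(n+1)}`. -/
theorem exists_sMul_mul_eq {n m : ℤ} (hm : n + 1 = m) {e x : B} (he : e ∈ rep.spanTS)
    (hx : ∀ p, ∃ e' ∈ sMul (rep.grading.comp n) (rep.grading.comp (-n)),
      e' * (rep.S p * x) = rep.S p * x) :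
    ∃ e' ∈ sMul (rep.grading.comp m) (rep.grading.comp (-m)), e' * x = e * x := by
  induction he using AddSubgroup.closure_induction with
  | mem z hz =>
    obtain ⟨q, p, rfl⟩ := hz
    obtain ⟨e', he', h⟩ := hx p
    refine ⟨rep.T q * e' * rep.S p, rep.grading.mul_mul_mem_sMul (rep.T_mem q) (rep.S_mem p) he'
      (by omega) (by omega), ?_⟩
    rw [mul_assoc, mul_assoc, h, mul_assoc]
  | zero => exact ⟨0, zero_mem _, rfl⟩
  | add a b _ _ ha hb =>
    obtain ⟨a', ha', ha⟩ := ha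
    obtain ⟨b', hb', hb⟩ := hb
    exact ⟨a' + b', add_mem ha' hb', by rw [add_mul, ha, hb, add_mul]⟩
  | neg a _ ha =>
    obtain ⟨a', ha', ha⟩ := ha
    exact ⟨-a', neg_mem ha', by rw [neg_mul, ha, neg_mul]⟩

/-- If `e` lies in the span of `T(Q) S(P)` and every `x T(q)` has a right unit in
`B_n B_{-n}`, then `x e` is `x e'` for some `e'` in `B_{n+1} B_{-(n+1)}`. -/
theorem exists_mul_sMul_eq {n m : ℤ} (hm : n + 1 = m) {e x : B} (he : e ∈ rep.spanTS)
    (hx : ∀ q, ∃ e' ∈ sMul (rep.grading.comp n) (rep.grading.comp (-n)),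
      x * rep.T q * e' = x * rep.T q) :
    ∃ e' ∈ sMul (rep.grading.comp m) (rep.grading.comp (-m)), x * e' = x * e := by
  induction he using AddSubgroup.closure_induction with
  | mem z hz =>
    obtain ⟨q, p, rfl⟩ := hz
    obtain ⟨e', he', h⟩ := hx q
    refine ⟨rep.T q * e' * rep.S p, rep.grading.mul_mul_mem_sMul (rep.T_mem q) (rep.S_mem p) he'
      (by omega) (by omega), ?_⟩
    rw [← mul_assoc, ← mul_assoc, h, mul_assoc]
  | zero => exact ⟨0, zero_mem _, rfl⟩
  | add a b _ _ ha hb =>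
    obtain ⟨a', ha', ha⟩ := ha
    obtain ⟨b', hb', hb⟩ := hb
    exact ⟨a' + b', add_mem ha' hb', by rw [mul_add, ha, hb, mul_add]⟩
  | neg a _ ha =>
    obtain ⟨a', ha', ha⟩ := ha
    exact ⟨-a', neg_mem ha', by rw [mul_neg, ha, mul_neg]⟩

theorem exists_left_unit_of_mem_comp_natCast (hsu : sys.IsSUnital) (hfs : CondFS sys)
    (h0 : ∀ x ∈ rep.grading.comp 0,
      ∃ e ∈ sMul (rep.grading.comp 0) (rep.grading.comp 0), e * x = x) (n : ℕ) :
    ∀ x ∈ rep.grading.comp n,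
      ∃ e ∈ sMul (rep.grading.comp n) (rep.grading.comp (-(n : ℤ))), e * x = x := by
  induction n with
  | zero => simpa using h0
  | succ n ih =>
    intro x hx
    have hx' := rep.comp_le_closure_isWord hsu _ hx
    obtain ⟨e, he, hex⟩ := rep.exists_spanTS_left_unit hfs (x := x) <| by
      refine AddSubgroup.closure_mono (fun w hw => ?_) hx'
      obtain ⟨q, y, rfl⟩ := CovRep.IsWord.exists_eq_T_mul hw (by omega)
      exact ⟨_, ⟨q, rfl⟩, y, trivial, rfl⟩
    obtain ⟨e', he', h⟩ := rep.exists_sMul_mul_eq (m := ((n + 1 : ℕ) : ℤ)) (by push_cast; rfl) he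
      fun p => ih _ (rep.grading.mul_mem_of_eq (rep.S_mem p) hx (by push_cast; ring))
    exact ⟨e', he', h.trans hex⟩

theorem exists_right_unit_of_mem_comp_neg_natCast (hsu : sys.IsSUnital) (hfs : CondFS sys)
    (h0 : ∀ x ∈ rep.grading.comp 0,
      ∃ f ∈ sMul (rep.grading.comp 0) (rep.grading.comp 0), x * f = x) (n : ℕ) :
    ∀ x ∈ rep.grading.comp (-(n : ℤ)),
      ∃ f ∈ sMul (rep.grading.comp n) (rep.grading.comp (-(n : ℤ))), x * f = x := by
  induction n with
  | zero => simpa using h0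
  | succ n ih =>
    intro x hx
    have hx' := rep.comp_le_closure_isWord hsu _ hx
    obtain ⟨e, he, hex⟩ := rep.exists_spanTS_right_unit hfs (x := x) <| by
      refine AddSubgroup.closure_mono (fun w hw => ?_) hx'
      obtain ⟨y, p, rfl⟩ := CovRep.IsWord.exists_eq_mul_S hw (by omega)
      exact ⟨y, trivial, _, ⟨p, rfl⟩, rfl⟩
    obtain ⟨e', he', h⟩ := rep.exists_mul_sMul_eq (m := ((n + 1 : ℕ) : ℤ)) (by push_cast; rfl) he
      fun q => ih _ (rep.grading.mul_mem_of_eq hx (rep.T_mem q) (by push_cast; ring))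
    exact ⟨e', he', h.trans hex⟩

end GradedCovRep

/-- If `x ∈ B_i` has a left unit in `B_i B_j`, `j = -i`, and `B_j B_i` has right units, then
`x` has a right unit in `B_j B_i`. -/
theorem ZGrading.exists_right_unit_of_left_unit (G : ZGrading B) {i j : ℤ} (hij : j + i = 0)
    (hJ : ∀ y ∈ sMul (G.comp j) (G.comp i), ∃ f ∈ sMul (G.comp j) (G.comp i), y * f = y)
    {x e : B} (hx : x ∈ G.comp i) (he : e ∈ sMul (G.comp i) (G.comp j)) (hex : e * x = x) :
    ∃ f ∈ sMul (G.comp j) (G.comp i), x * f = x := by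
  have hmem : e * x ∈ sMul (G.comp i) (sMul (G.comp j) (G.comp i)) := by
    clear hex
    induction he using AddSubgroup.closure_induction with
    | mem z hz =>
      obtain ⟨a, ha, b, hb, rfl⟩ := hz
      rw [mul_assoc]
      exact mul_mem_sMul ha (mul_mem_sMul hb hx)
    | zero => simp
    | add a b _ _ ha hb =>
      rw [add_mul]
      exact add_mem ha hb
    | neg a _ ha =>
      rw [neg_mul]
      exact neg_mem ha
  rw [hex] at hmem
  obtain ⟨ys, hys, h⟩ := exists_list_right_unit_of_mem_sMul hmem
  obtain ⟨f, hf, hf'⟩ := exists_common_right_unit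
    (J := sMul (G.comp j) (G.comp i)) (fun _ ha _ hb => G.sMul_neg_mul_mem hij ha hb)
    hJ ys hys
  exact ⟨f, hf, h f hf'⟩

/-- If `x ∈ B_j` has a right unit in `B_i B_j`, `j = -i`, and `B_j B_i` has left units, then
`x` has a left unit in `B_j B_i`. -/
theorem ZGrading.exists_left_unit_of_right_unit (G : ZGrading B) {i j : ℤ} (hij : j + i = 0)
    (hJ : ∀ y ∈ sMul (G.comp j) (G.comp i), ∃ e ∈ sMul (G.comp j) (G.comp i), e * y = y)
    {x f : B} (hx : x ∈ G.comp j) (hf : f ∈ sMul (G.comp i) (G.comp j)) (hxf : x * f = x) :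
    ∃ e ∈ sMul (G.comp j) (G.comp i), e * x = x := by
  have hmem : x * f ∈ sMul (sMul (G.comp j) (G.comp i)) (G.comp j) := by
    clear hxf
    induction hf using AddSubgroup.closure_induction with
    | mem z hz =>
      obtain ⟨a, ha, b, hb, rfl⟩ := hz
      rw [← mul_assoc]
      exact mul_mem_sMul (mul_mem_sMul hx ha) hb
    | zero => simp
    | add a b _ _ ha hb =>
      rw [mul_add]
      exact add_mem ha hb
    | neg a _ ha =>
      rw [mul_neg]
      exact neg_mem ha
  rw [hxf] at hmem
  obtain ⟨ys, hys, h⟩ := exists_list_left_unit_of_mem_sMul hmem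
  obtain ⟨e, he, he'⟩ := exists_common_left_unit
    (J := sMul (G.comp j) (G.comp i)) (fun _ ha _ hb => G.sMul_neg_mul_mem hij ha hb)
    hJ ys hys
  exact ⟨e, he, h e he'⟩

end Auxiliary

/-- Let `R` be an s-unital ring, `(P,Q,ψ)` an s-unital `R`-system satisfying
Condition (FS), and `(S,T,σ,B)` a semi-full graded covariant representation such that each
ideal `I^(k)` of `B₀` is s-unital. Then `B` is nearly epsilon-strongly ℤ-graded. -/
theorem nearly_epsilon_strong_of_semiFull
    {R P Q B : Type*} [NonUnitalRing R] [AddCommGroup P] [AddCommGroup Q] [NonUnitalRing B]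
    (sys : RSystem R P Q) (hsu : sys.IsSUnital) (hfs : CondFS sys)
    (rep : GradedCovRep sys B) (hsf : SemiFull rep)
    (hI : ∀ k : ℕ, ∀ x ∈ idealI rep k,
      (∃ e ∈ idealI rep k, e * x = x) ∧ (∃ f ∈ idealI rep k, x * f = x)) :
    ∀ i : ℤ, ∀ x ∈ rep.grading.comp i,
      (∃ e ∈ sMul (rep.grading.comp i) (rep.grading.comp (-i)), e * x = x) ∧
      (∃ f ∈ sMul (rep.grading.comp (-i)) (rep.grading.comp i), x * f = x) := by
  have hJ (k : ℕ) (x : B)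
      (hx : x ∈ sMul (rep.grading.comp (-(k : ℤ))) (rep.grading.comp (k : ℤ))) :
      (∃ e ∈ sMul (rep.grading.comp (-(k : ℤ))) (rep.grading.comp (k : ℤ)), e * x = x) ∧
      (∃ f ∈ sMul (rep.grading.comp (-(k : ℤ))) (rep.grading.comp (k : ℤ)), x * f = x) := by
    rw [hsf k] at hx ⊢
    exact hI k x hx
  have h0 (x : B) (hx : x ∈ rep.grading.comp 0) :
      (∃ e ∈ sMul (rep.grading.comp 0) (rep.grading.comp 0), e * x = x) ∧
      (∃ f ∈ sMul (rep.grading.comp 0) (rep.grading.comp 0), x * f = x) := by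
    simpa using hJ 0 x (by simpa using rep.comp_zero_le_sMul hsu hx)
  intro i x hx
  obtain ⟨n, rfl | rfl⟩ := Int.eq_nat_or_neg i
  · obtain ⟨e, he, hex⟩ := rep.exists_left_unit_of_mem_comp_natCast hsu hfs
      (fun y hy => (h0 y hy).1) n x hx
    exact ⟨⟨e, he, hex⟩, rep.grading.exists_right_unit_of_left_unit (neg_add_cancel _)
      (fun y hy => (hJ n y hy).2) hx he hex⟩
  · obtain ⟨f, hf, hxf⟩ := rep.exists_right_unit_of_mem_comp_neg_natCast hsu hfs
      (fun y hy => (h0 y hy).2) n x hx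
    rw [neg_neg]
    exact ⟨rep.grading.exists_left_unit_of_right_unit (neg_add_cancel _)
      (fun y hy => (hJ n y hy).1) hx hf hxf, ⟨f, hf, hxf⟩⟩
end

section
/- Let A be a unital ℤ-graded ring with elements t₋ ∈ A₁ and t₊ ∈ A₋₁ such that t₋t₊ = 1, A_i = t₋ⁱA₀ for every i > 0 and A_{-i} = A₀t₊ⁱ for every i > 0 (so A is the corner skew Laurent polynomial ring A₀[t₊,t₋;α]). Then A is left noetherian if and only if A₀ is left noetherian, and A is right noetherian if and only if A₀ is right noetherian. -/
set_option maxHeartbeats 800000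

/-- `Ann_{A₀}(A₁) = {r ∈ A₀ : r·x = 0 for all x ∈ A₁}`. -/
def annA1 {A : Type*} [NonUnitalRing A] (G : ZGrading A) : Set A :=
  {r | r ∈ G.comp 0 ∧ ∀ x ∈ G.comp 1, r * x = 0}

/-- For a subset `J` of `A₀`, `J^⊥ = {r ∈ A₀ : r x = 0 and x r = 0 for all x ∈ J}`. -/
def perp {A : Type*} [NonUnitalRing A] (G : ZGrading A) (J : Set A) : Set A :=
  {r | r ∈ G.comp 0 ∧ ∀ x ∈ J, r * x = 0 ∧ x * r = 0}

/-- `I` is a left ideal of the subring `B0` (both viewed as additive subgroups of `A`). -/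
def LeftIdealOf {A : Type*} [NonUnitalRing A] (B0 I : AddSubgroup A) : Prop :=
  I ≤ B0 ∧ ∀ a ∈ B0, ∀ x ∈ I, a * x ∈ I

/-- `I` is a right ideal of the subring `B0`. -/
def RightIdealOf {A : Type*} [NonUnitalRing A] (B0 I : AddSubgroup A) : Prop :=
  I ≤ B0 ∧ ∀ a ∈ B0, ∀ x ∈ I, x * a ∈ I

/-- The ascending chain condition on the additive subgroups satisfying `p`. -/
def ACCOn {A : Type*} [NonUnitalRing A] (p : AddSubgroup A → Prop) : Prop :=
  ∀ f : ℕ → AddSubgroup A, (∀ n, p (f n)) → Monotone f → ∃ n, ∀ m, n ≤ m → f m = f n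

open MulOpposite

namespace ZGrading

section Internal

variable {ι M : Type*} [DecidableEq ι] [AddCommGroup M] {C : ι → AddSubgroup M}

theorem iSup_eq_top_of_isInternal (h : DirectSum.IsInternal C) : ⨆ i, C i = ⊤ := by
  refine (AddSubgroup.eq_top_iff' _).2 fun x => ?_
  obtain ⟨d, rfl⟩ := h.surjective x
  induction d using DirectSum.induction_on with
  | zero => simp
  | of i y => simpa using AddSubgroup.mem_iSup_of_mem i y.2
  | add a b ha hb => simpa using add_mem ha hb

theorem isInternal_of_iSupIndep_of_iSup_eq_top (hi : iSupIndep C) (ht : ⨆ i, C i = ⊤) :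
    DirectSum.IsInternal C := by
  refine ⟨hi.dfinsuppSumAddHom_injective, ?_⟩
  have hle : (⨆ i, C i) ≤ (DirectSum.coeAddMonoidHom C).range :=
    iSup_le fun i y hy => ⟨DirectSum.of (fun i => C i) i ⟨y, hy⟩, by simp⟩
  intro x
  exact hle (ht ▸ AddSubgroup.mem_top x)

end Internal

section Opposite

variable {A : Type*} [Ring A]

/-- The opposite ring, graded by `(Aᵐᵒᵖ)_i = A_{-i}`. -/
def op (G : ZGrading A) : ZGrading Aᵐᵒᵖ where
  comp i := (opAddEquiv : A ≃+ Aᵐᵒᵖ).mapAddSubgroup (G.comp (-i))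
  isInternal := by
    refine isInternal_of_iSupIndep_of_iSup_eq_top ?_ ?_
    · exact (iSupIndep_map_orderIso_iff (opAddEquiv : A ≃+ Aᵐᵒᵖ).mapAddSubgroup).2
        (G.isInternal.addSubgroup_iSupIndep.comp neg_injective)
    · rw [← OrderIso.map_iSup, neg_surjective.iSup_comp,
        iSup_eq_top_of_isInternal G.isInternal, OrderIso.map_top]
  mul_mem := by
    rintro i j _ _ ⟨x, hx, rfl⟩ ⟨y, hy, rfl⟩
    refine ⟨y * x, ?_, rfl⟩
    have h := G.mul_mem hy hx
    rwa [← neg_add_rev] at h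

theorem op_mem_op_comp {G : ZGrading A} {x : A} {i : ℤ} (hx : x ∈ G.comp (-i)) :
    MulOpposite.op x ∈ G.op.comp i :=
  ⟨x, hx, rfl⟩

end Opposite

end ZGrading

theorem accOn_iff_of_orderIso {A B : Type*} [NonUnitalRing A] [NonUnitalRing B]
    (e : AddSubgroup A ≃o AddSubgroup B) {p : AddSubgroup A → Prop} {q : AddSubgroup B → Prop}
    (h : ∀ I, p I ↔ q (e I)) : ACCOn p ↔ ACCOn q := by
  constructor
  · intro hp f hf hm
    obtain ⟨n, hn⟩ := hp (fun k => e.symm (f k)) (fun k => by simpa [h] using hf k)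
      (e.symm.monotone.comp hm)
    exact ⟨n, fun m hnm => e.symm.injective (hn m hnm)⟩
  · intro hq f hf hm
    obtain ⟨n, hn⟩ := hq (fun k => e (f k)) (fun k => (h _).1 (hf k)) (e.monotone.comp hm)
    exact ⟨n, fun m hnm => e.injective (hn m hnm)⟩

theorem accOn_rightIdealOf_iff_op {A : Type*} [Ring A] (B : AddSubgroup A) :
    ACCOn (RightIdealOf B) ↔
      ACCOn (LeftIdealOf ((opAddEquiv : A ≃+ Aᵐᵒᵖ).mapAddSubgroup B)) := by
  refine accOn_iff_of_orderIso (opAddEquiv : A ≃+ Aᵐᵒᵖ).mapAddSubgroup fun I => ?_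
  refine and_congr (OrderIso.le_iff_le _).symm ?_
  constructor
  · rintro h _ ⟨a, ha, rfl⟩ _ ⟨x, hx, rfl⟩
    exact ⟨x * a, h a ha x hx, rfl⟩
  · intro h a ha x hx
    obtain ⟨y, hy, hyx⟩ := h _ ⟨a, ha, rfl⟩ _ ⟨x, hx, rfl⟩
    rwa [show x * a = y from op_injective hyx.symm]

namespace ZGrading

variable {A : Type*} [Ring A] (G : ZGrading A)

theorem pow_mem (h1 : (1 : A) ∈ G.comp 0) {x : A} {i : ℤ} (hx : x ∈ G.comp i) (n : ℕ) :
    x ^ n ∈ G.comp (n * i) := by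
  induction n with
  | zero => simpa using h1
  | succ n ih =>
    have h := G.mul_mem ih hx
    rw [← pow_succ] at h
    convert h using 2
    push_cast
    ring

theorem exists_zero_proj (h1 : (1 : A) ∈ G.comp 0) :
    ∃ π : A →+ A, (∀ a, π a ∈ G.comp 0) ∧ (∀ r ∈ G.comp 0, π r = r) ∧
      ∀ a, ∀ r ∈ G.comp 0, π (a * r) = π a * r := by
  let := G.isInternal.chooseDecomposition
  let : GradedRing G.comp :=
    { one_mem := h1
      mul_mem := fun _ _ _ _ hx hy => G.mul_mem hx hy }
  exact ⟨GradedRing.proj G.comp 0, fun a => (DirectSum.decompose G.comp a 0).2,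
    fun r hr => DirectSum.decompose_of_mem_same G.comp hr,
    fun a r hr => DirectSum.coe_decompose_mul_of_right_mem_zero G.comp hr⟩

theorem accOn_leftIdealOf_zero (h1 : (1 : A) ∈ G.comp 0)
    (h : ACCOn (LeftIdealOf (⊤ : AddSubgroup A))) : ACCOn (LeftIdealOf (G.comp 0)) := by
  obtain ⟨π, hπ0, hπ, hmul⟩ := G.exists_zero_proj h1
  intro f hf hm
  let J (k : ℕ) : AddSubgroup A := ⨅ a : A, (f k).comap (π.comp (AddMonoidHom.mulLeft a))
  have hJ : ∀ {k x}, x ∈ J k ↔ ∀ a, π (a * x) ∈ f k := by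
    simp [J, AddSubgroup.mem_iInf]
  obtain ⟨n, hn⟩ := h J
    (fun k => ⟨le_top, fun a _ x hx => hJ.2 fun b => by
      rw [← mul_assoc]
      exact hJ.1 hx (b * a)⟩)
    (fun k l hkl x hx => hJ.2 fun a => hm hkl (hJ.1 hx a))
  refine ⟨n, fun m hnm => le_antisymm (fun r hr => ?_) (hm hnm)⟩
  have hr0 := (hf m).1 hr
  have hrJ : r ∈ J m := hJ.2 fun a => by
    rw [hmul a r hr0]
    exact (hf m).2 _ (hπ0 a) r hr
  rw [hn m hnm] at hrJ
  simpa [hπ r hr0] using hJ.1 hrJ 1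

/-- The sum of the components of degrees `0, …, n - 1`. -/
def polyLT : ℕ → AddSubgroup A
  | 0 => ⊥
  | n + 1 => polyLT n ⊔ G.comp n

theorem polyLT_mono : Monotone G.polyLT :=
  monotone_nat_of_le_succ fun _ => le_sup_left

variable {G}

theorem mul_mem_polyLT_add {a : A} {d : ℕ} (ha : a ∈ G.comp d) {n : ℕ} {y : A}
    (hy : y ∈ G.polyLT n) : a * y ∈ G.polyLT (n + d) := by
  induction n generalizing y with
  | zero => simp [(AddSubgroup.mem_bot).1 hy]
  | succ n ih =>
    obtain ⟨z, hz, w, hw, rfl⟩ := AddSubgroup.mem_sup.1 hy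
    rw [mul_add]
    refine add_mem (G.polyLT_mono (by omega) (ih hz)) ?_
    rw [add_right_comm]
    refine AddSubgroup.mem_sup_right ?_
    have h := G.mul_mem ha hw
    rwa [add_comm, ← Nat.cast_add] at h

variable (G) in
/-- The coefficients `r ∈ A₀` of leading terms `u ^ n * r` of elements of `I` supported in
degrees `0, …, n`. -/
def leadingCoeffs (u : A) (I : AddSubgroup A) (n : ℕ) : AddSubgroup A where
  carrier := {r | r ∈ G.comp 0 ∧ ∃ y ∈ G.polyLT n, u ^ n * r + y ∈ I}
  zero_mem' := ⟨zero_mem _, 0, zero_mem _, by simp⟩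
  add_mem' := by
    rintro r s ⟨hr, y, hy, hry⟩ ⟨hs, z, hz, hsz⟩
    refine ⟨add_mem hr hs, y + z, add_mem hy hz, ?_⟩
    rw [mul_add, add_add_add_comm]
    exact add_mem hry hsz
  neg_mem' := by
    rintro r ⟨hr, y, hy, hry⟩
    refine ⟨neg_mem hr, -y, neg_mem hy, ?_⟩
    rw [mul_neg, ← neg_add]
    exact neg_mem hry

theorem leadingCoeffs_mono (u : A) {I J : AddSubgroup A} (h : I ≤ J) (n : ℕ) :
    G.leadingCoeffs u I n ≤ G.leadingCoeffs u J n :=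
  fun _ ⟨hr, y, hy, hry⟩ => ⟨hr, y, hy, h hry⟩

section Unit

variable {u v : A} {I J : AddSubgroup A}

theorem leadingCoeffs_monotone
    (hu : u ∈ G.comp 1)
    (hI : LeftIdealOf ⊤ I) : Monotone (G.leadingCoeffs u I) := by
  refine monotone_nat_of_le_succ fun n => ?_
  rintro r ⟨hr, y, hy, hry⟩
  refine ⟨hr, u * y, mul_mem_polyLT_add (d := 1) (by simpa using hu) hy, ?_⟩
  rw [pow_succ', mul_assoc, ← mul_add]
  exact hI.2 u trivial _ hry

theorem leadingCoeffs_leftIdealOf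
    (h1 : (1 : A) ∈ G.comp 0) (hu : u ∈ G.comp 1) (hv : v ∈ G.comp (-1)) (hvu : v * u = 1)
    (hI : LeftIdealOf ⊤ I) (n : ℕ) :
    LeftIdealOf (G.comp 0) (G.leadingCoeffs u I n) := by
  refine ⟨fun r hr => hr.1, ?_⟩
  rintro a ha r ⟨hr, y, hy, hry⟩
  have hvn : v ^ n * u ^ n = 1 := pow_mul_pow_eq_one n hvu
  have hc : u ^ n * a * v ^ n ∈ G.comp 0 := by
    simpa using G.mul_mem (G.mul_mem (G.pow_mem h1 hu n) ha) (G.pow_mem h1 hv n)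
  refine ⟨by simpa using G.mul_mem ha hr, u ^ n * a * v ^ n * y,
    mul_mem_polyLT_add (d := 0) (by simpa using hc) hy, ?_⟩
  have h := hI.2 (u ^ n * a * v ^ n) trivial _ hry
  rwa [mul_add, mul_assoc _ (v ^ n), ← mul_assoc (v ^ n), hvn, one_mul, mul_assoc _ a] at h

theorem mem_of_mem_polyLT
    (h1 : (1 : A) ∈ G.comp 0) (hv : v ∈ G.comp (-1)) (huv : u * v = 1)
    (hIJ : J ≤ I)
    (hL : ∀ n, G.leadingCoeffs u I n ≤ G.leadingCoeffs u J n) {n : ℕ} {x : A}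
    (hx : x ∈ G.polyLT n) (hxI : x ∈ I) : x ∈ J := by
  induction n generalizing x with
  | zero => simp [(AddSubgroup.mem_bot).1 hx]
  | succ n ih =>
    obtain ⟨y, hy, z, hz, rfl⟩ := AddSubgroup.mem_sup.1 hx
    have hz' : u ^ n * (v ^ n * z) = z := by
      rw [← mul_assoc, pow_mul_pow_eq_one n huv, one_mul]
    have hr : v ^ n * z ∈ G.leadingCoeffs u I n := by
      refine ⟨by simpa using G.mul_mem (G.pow_mem h1 hv n) hz, y, hy, ?_⟩
      rwa [hz', add_comm]
    obtain ⟨-, w, hw, hwJ⟩ := hL n hr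
    rw [hz'] at hwJ
    have h := ih (sub_mem hy hw) (by simpa [add_comm y z] using sub_mem hxI (hIJ hwJ))
    simpa using add_mem h hwJ

theorem exists_pow_mul_mem_polyLT
    (h1 : (1 : A) ∈ G.comp 0) (hu : u ∈ G.comp 1)
    (x : A) : ∃ m n : ℕ, u ^ m * x ∈ G.polyLT n := by
  have hx : x ∈ ⨆ i, G.comp i := iSup_eq_top_of_isInternal G.isInternal ▸ AddSubgroup.mem_top x
  have hup : ∀ k : ℕ, u ^ k ∈ G.comp k := fun k => by simpa using G.pow_mem h1 hu k
  induction hx using AddSubgroup.iSup_induction' with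
  | hp i x hx =>
    refine ⟨i.natAbs, (i + i.natAbs).toNat + 1, AddSubgroup.mem_sup_right ?_⟩
    have h := G.mul_mem (hup i.natAbs) hx
    rwa [Int.toNat_of_nonneg (by omega), add_comm]
  | h1 => exact ⟨0, 0, by simp⟩
  | hadd x y _ _ hx hy =>
    obtain ⟨m, n, hmn⟩ := hx
    obtain ⟨k, l, hkl⟩ := hy
    refine ⟨m + k, (n + k) + (l + m), ?_⟩
    rw [mul_add]
    refine add_mem (G.polyLT_mono (Nat.le_add_right _ _) ?_)
      (G.polyLT_mono (Nat.le_add_left _ _) ?_)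
    · rw [add_comm m, pow_add, mul_assoc]
      exact mul_mem_polyLT_add (hup k) hmn
    · rw [pow_add, mul_assoc]
      exact mul_mem_polyLT_add (hup m) hkl

theorem le_of_leadingCoeffs_le
    (h1 : (1 : A) ∈ G.comp 0) (hu : u ∈ G.comp 1) (hv : v ∈ G.comp (-1))
    (huv : u * v = 1) (hvu : v * u = 1)
    (hI : LeftIdealOf ⊤ I) (hJ : LeftIdealOf ⊤ J) (hIJ : J ≤ I)
    (hL : ∀ n, G.leadingCoeffs u I n ≤ G.leadingCoeffs u J n) : I ≤ J := by
  intro x hx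
  obtain ⟨m, n, hmn⟩ := exists_pow_mul_mem_polyLT h1 hu x
  have h := hJ.2 (v ^ m) trivial _
    (mem_of_mem_polyLT h1 hv huv hIJ hL hmn (hI.2 (u ^ m) trivial x hx))
  rwa [← mul_assoc, pow_mul_pow_eq_one m hvu, one_mul] at h

/-- Hilbert's basis theorem for skew Laurent polynomial rings. -/
theorem accOn_leftIdealOf_top_of_unit
    (h1 : (1 : A) ∈ G.comp 0) (hu : u ∈ G.comp 1) (hv : v ∈ G.comp (-1))
    (huv : u * v = 1) (hvu : v * u = 1)
    (h : ACCOn (LeftIdealOf (G.comp 0))) :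
    ACCOn (LeftIdealOf (⊤ : AddSubgroup A)) := by
  intro f hf hm
  have hL := fun k n => leadingCoeffs_leftIdealOf h1 hu hv hvu (hf k) n
  have hmono : ∀ {k l m n : ℕ}, k ≤ l → m ≤ n →
      G.leadingCoeffs u (f k) m ≤ G.leadingCoeffs u (f l) n := fun hkl hmn =>
    (leadingCoeffs_mono u (hm hkl) _).trans (leadingCoeffs_monotone hu (hf _) hmn)
  obtain ⟨m, hdiag⟩ := h (fun k => G.leadingCoeffs u (f k) k) (fun k => hL k k)
    fun _ _ hkl => hmono hkl hkl
  choose K hK using fun n => h (fun k => G.leadingCoeffs u (f k) n) (fun k => hL k n)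
    fun _ _ hkl => hmono hkl le_rfl
  set N := max m ((Finset.range m).sup K) with hN
  refine ⟨N, fun k hk => le_antisymm ?_ (hm hk)⟩
  refine le_of_leadingCoeffs_le h1 hu hv huv hvu (hf k) (hf N) (hm hk) fun n => ?_
  rcases lt_or_ge n m with hn | hn
  · have hKN : K n ≤ N := (Finset.le_sup (Finset.mem_range.2 hn)).trans (le_max_right _ _)
    exact ((hK n k (hKN.trans hk)).trans (hK n N hKN).symm).le
  · calc G.leadingCoeffs u (f k) n
        ≤ G.leadingCoeffs u (f (max k n)) (max k n) := hmono (le_max_left _ _) (le_max_right _ _)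
      _ = G.leadingCoeffs u (f m) m := hdiag _ (hn.trans (le_max_right _ _))
      _ ≤ G.leadingCoeffs u (f N) n := hmono (le_max_left _ _) hn

end Unit

/-- If `A₀` is left noetherian, the idempotent `tp * tm` of a corner skew Laurent polynomial
ring is the identity. -/
theorem mul_eq_one_of_accOn {tm tp : A} (htm : tm ∈ G.comp 1) (htp : tp ∈ G.comp (-1))
    (h1 : (1 : A) ∈ G.comp 0) (hunit : tm * tp = 1) (h : ACCOn (LeftIdealOf (G.comp 0))) :
    tp * tm = 1 := by
  have hpow : ∀ n : ℕ, tm ^ n * tp ^ n = 1 := fun n => pow_mul_pow_eq_one n hunit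
  obtain ⟨n, hn⟩ := h (fun n => G.comp 0 ⊓ (AddMonoidHom.mulRight (tp ^ n)).ker)
    (fun n => ⟨inf_le_left, fun a ha x hx => ⟨by simpa using G.mul_mem ha hx.1, by
      have hx0 : x * tp ^ n = 0 := hx.2
      simp [mul_assoc, hx0]⟩⟩)
    (monotone_nat_of_le_succ fun n x hx => ⟨hx.1, by
      have hx0 : x * tp ^ n = 0 := hx.2
      simp [pow_succ, ← mul_assoc, hx0]⟩)
  have hmem : 1 - tp ^ (n + 1) * tm ^ (n + 1) ∈
      G.comp 0 ⊓ (AddMonoidHom.mulRight (tp ^ (n + 1))).ker := by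
    refine AddSubgroup.mem_inf.2 ⟨sub_mem h1 ?_, ?_⟩
    · simpa [-Nat.cast_add] using
        G.mul_mem (G.pow_mem h1 htp (n + 1)) (G.pow_mem h1 htm (n + 1))
    · simp [AddMonoidHom.mem_ker, sub_mul, mul_assoc, hpow]
  have h0 : (1 - tp ^ (n + 1) * tm ^ (n + 1)) * tp ^ n = 0 :=
    ((hn (n + 1) n.le_succ).le hmem).2
  have hn' : tp ^ n = tp ^ n * (tp * tm) := by
    rw [sub_mul, one_mul, sub_eq_zero, pow_succ' tm, mul_assoc, mul_assoc, hpow, mul_one,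
      pow_succ, mul_assoc] at h0
    exact h0
  calc tp * tm = tm ^ n * (tp ^ n * (tp * tm)) := by rw [← mul_assoc, hpow, one_mul]
    _ = 1 := by rw [← hn', hpow]

theorem accOn_leftIdealOf_top_iff {tm tp : A} (htm : tm ∈ G.comp 1) (htp : tp ∈ G.comp (-1))
    (hunit : tm * tp = 1) :
    ACCOn (LeftIdealOf (⊤ : AddSubgroup A)) ↔ ACCOn (LeftIdealOf (G.comp 0)) := by
  have h1 : (1 : A) ∈ G.comp 0 := by simpa [hunit] using G.mul_mem htm htp
  exact ⟨G.accOn_leftIdealOf_zero h1, fun h => accOn_leftIdealOf_top_of_unit h1 htm htp hunit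
    (mul_eq_one_of_accOn htm htp h1 hunit h) h⟩

end ZGrading

/-- A corner skew Laurent polynomial ring `A = A₀[t₊,t₋;α]` is left (right)
noetherian if and only if `A₀` is left (right) noetherian. -/
theorem cornerSkewLaurent_noetherian_iff
    {A : Type*} [Ring A] (G : ZGrading A) (tm tp : A)
    (htm : tm ∈ G.comp 1) (htp : tp ∈ G.comp (-1)) (hunit : tm * tp = 1)
    (hpos : ∀ n : ℕ,
      (G.comp ((n : ℤ) + 1) : Set A) = {x | ∃ r ∈ G.comp 0, x = tm ^ (n + 1) * r})
    (hneg : ∀ n : ℕ,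
      (G.comp (-((n : ℤ) + 1)) : Set A) = {x | ∃ r ∈ G.comp 0, x = r * tp ^ (n + 1)}) :
    (ACCOn (LeftIdealOf (⊤ : AddSubgroup A)) ↔ ACCOn (LeftIdealOf (G.comp 0))) ∧
    (ACCOn (RightIdealOf (⊤ : AddSubgroup A)) ↔ ACCOn (RightIdealOf (G.comp 0))) := by
  refine ⟨ZGrading.accOn_leftIdealOf_top_iff htm htp hunit, ?_⟩
  rw [accOn_rightIdealOf_iff_op, accOn_rightIdealOf_iff_op, OrderIso.map_top]
  exact ZGrading.accOn_leftIdealOf_top_iff (G := G.op) (ZGrading.op_mem_op_comp htp)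
    (ZGrading.op_mem_op_comp (by simpa using htm)) (congrArg op hunit)
end

section
/- Let A be a nontrivial (1 ≠ 0) unital ℤ-graded ring with elements t₋ ∈ A₁ and t₊ ∈ A₋₁ such that t₋t₊ = 1, A_i = t₋ⁱA₀ for every i > 0 and A_{-i} = A₀t₊ⁱ for every i > 0 (so A is the corner skew Laurent polynomial ring A₀[t₊,t₋;α]). Then A is neither left artinian nor right artinian. -/
set_option maxHeartbeats 800000

/-- The descending chain condition on the additive subgroups satisfying `p`. -/
def DCCOn {A : Type*} [NonUnitalRing A] (p : AddSubgroup A → Prop) : Prop :=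
  ∀ f : ℕ → AddSubgroup A, (∀ n, p (f n)) → Antitone f → ∃ n, ∀ m, n ≤ m → f m = f n

section ShiftMaps

variable {M : Type*} [AddCommGroup M] (ℳ : ℤ → AddSubgroup M) [DirectSum.Decomposition ℳ]

theorem decompose_map_of_shift {φ : M →+ M} (hφ : ∀ i, ∀ x ∈ ℳ i, φ x ∈ ℳ (i + 1))
    (x : M) (i : ℤ) :
    (DirectSum.decompose ℳ (φ x) (i + 1) : M) = φ (DirectSum.decompose ℳ x i) := by
  induction x using DirectSum.Decomposition.inductionOn ℳ with
  | zero => simp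
  | @homogeneous j m =>
    by_cases h : j = i
    · subst h
      rw [DirectSum.decompose_of_mem_same ℳ (hφ j m m.2), DirectSum.decompose_of_mem_same ℳ m.2]
    · rw [DirectSum.decompose_of_mem_ne ℳ (hφ j m m.2) (by omega),
        DirectSum.decompose_of_mem_ne ℳ m.2 h, map_zero]
  | add a b ha hb => simp [DirectSum.decompose_add, ha, hb]

theorem exists_nat_decompose_eq_zero (x : M) :
    ∃ N : ℕ, ∀ i : ℤ, N ≤ i.natAbs → (DirectSum.decompose ℳ x i : M) = 0 := by
  classical
  refine ⟨(DirectSum.decompose ℳ x).support.sup Int.natAbs + 1, fun i hi => ?_⟩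
  by_contra h
  have hmem : i ∈ (DirectSum.decompose ℳ x).support :=
    DFinsupp.mem_support_iff.2 fun h0 => h (by rw [h0]; rfl)
  have := Finset.le_sup (f := Int.natAbs) hmem
  omega

/-- If `x - φ x` has no components of degree `< d`, then neither has `x`. -/
theorem decompose_eq_zero_of_shift {φ : M →+ M} (hφ : ∀ i, ∀ x ∈ ℳ i, φ x ∈ ℳ (i + 1))
    {x y : M} (hx : x = φ x + y) {d : ℤ}
    (hy : ∀ i < d, (DirectSum.decompose ℳ y i : M) = 0) :
    ∀ i < d, (DirectSum.decompose ℳ x i : M) = 0 := by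
  obtain ⟨N, hN⟩ := exists_nat_decompose_eq_zero ℳ x
  have key : ∀ k : ℕ, -(N : ℤ) + k < d →
      (DirectSum.decompose ℳ x (-(N : ℤ) + k) : M) = 0 := by
    intro k
    induction k with
    | zero => exact fun _ => hN _ (by simp)
    | succ k ih =>
      intro hk
      push_cast at hk ⊢
      rw [← add_assoc] at hk ⊢
      rw [hx, DirectSum.decompose_add, DirectSum.add_apply, AddSubgroup.coe_add,
        decompose_map_of_shift ℳ hφ, ih (by omega), map_zero, hy _ hk, add_zero]
  intro i hi
  by_cases h : -(N : ℤ) ≤ i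
  · have := key (i + N).toNat (by omega)
    rwa [show -(N : ℤ) + ((i + N).toNat : ℤ) = i by omega] at this
  · exact hN i (by omega)

theorem eq_zero_of_shift_eq_self {φ : M →+ M} (hφ : ∀ i, ∀ x ∈ ℳ i, φ x ∈ ℳ (i + 1))
    {x : M} (hx : φ x = x) : x = 0 := by
  apply (DirectSum.decompose ℳ).injective
  ext i
  simpa using decompose_eq_zero_of_shift ℳ hφ (y := 0) (d := i + 1) (by simp [hx])
    (by simp) i (by omega)

/-- The equation `x - φ x = y` with `y` of degree `0` forces some iterate of `φ` to kill `y`. -/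
theorem exists_iterate_eq_zero_of_shift {φ : M →+ M}
    (hφ : ∀ i, ∀ x ∈ ℳ i, φ x ∈ ℳ (i + 1)) {x y : M} (hy : y ∈ ℳ 0) (hx : x = φ x + y) :
    ∃ n : ℕ, φ^[n] y = 0 := by
  have key : ∀ n : ℕ, (DirectSum.decompose ℳ x (n : ℤ) : M) = φ^[n] y := by
    intro n
    induction n with
    | zero =>
      have hneg := decompose_eq_zero_of_shift ℳ hφ hx (d := 0)
        (fun i hi => DirectSum.decompose_of_mem_ne ℳ hy hi.ne') (-1) (by omega)
      have h := decompose_map_of_shift ℳ hφ x (-1)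
      rw [hneg, map_zero] at h
      rw [hx, DirectSum.decompose_add, DirectSum.add_apply, AddSubgroup.coe_add]
      simpa [DirectSum.decompose_of_mem_same ℳ hy] using h
    | succ n ih =>
      rw [hx, DirectSum.decompose_add, DirectSum.add_apply, AddSubgroup.coe_add,
        DirectSum.decompose_of_mem_ne ℳ hy (by omega), Nat.cast_succ,
        decompose_map_of_shift ℳ hφ, ih, Function.iterate_succ_apply', add_zero]
  obtain ⟨N, hN⟩ := exists_nat_decompose_eq_zero ℳ x
  exact ⟨N, by rw [← key, hN _ (by simp)]⟩

end ShiftMaps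

theorem exists_mul_eq_one_of_dccOn_leftIdealOf {A : Type*} [Ring A]
    (h : DCCOn (LeftIdealOf (⊤ : AddSubgroup A))) {s : A} (hs : IsRightRegular s) :
    ∃ a, a * s = 1 := by
  obtain ⟨n, hn⟩ := h (fun n => (AddMonoidHom.mulRight (s ^ n)).range)
    (fun n => ⟨le_top, by
      rintro a - _ ⟨b, rfl⟩
      exact ⟨a * b, by simp [mul_assoc]⟩⟩)
    (antitone_nat_of_succ_le fun n => by
      rintro _ ⟨b, rfl⟩
      exact ⟨b * s, by simp [pow_succ', mul_assoc]⟩)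
  have hmem : s ^ n ∈ (AddMonoidHom.mulRight (s ^ (n + 1))).range := by
    rw [hn (n + 1) n.le_succ]
    exact ⟨1, by simp⟩
  obtain ⟨a, ha⟩ := hmem
  exact ⟨a, hs.pow n (by simpa [pow_succ', mul_assoc] using ha)⟩

theorem exists_mul_eq_one_of_dccOn_rightIdealOf {A : Type*} [Ring A]
    (h : DCCOn (RightIdealOf (⊤ : AddSubgroup A))) {s : A} (hs : IsLeftRegular s) :
    ∃ a, s * a = 1 := by
  obtain ⟨n, hn⟩ := h (fun n => (AddMonoidHom.mulLeft (s ^ n)).range)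
    (fun n => ⟨le_top, by
      rintro a - _ ⟨b, rfl⟩
      exact ⟨b * a, by simp [mul_assoc]⟩⟩)
    (antitone_nat_of_succ_le fun n => by
      rintro _ ⟨b, rfl⟩
      exact ⟨s * b, by simp [pow_succ, mul_assoc]⟩)
  have hmem : s ^ n ∈ (AddMonoidHom.mulLeft (s ^ (n + 1))).range := by
    rw [hn (n + 1) n.le_succ]
    exact ⟨1, by simp⟩
  obtain ⟨a, ha⟩ := hmem
  exact ⟨a, hs.pow n (by simpa [pow_succ, mul_assoc] using ha)⟩

/-- A nontrivial corner skew Laurent polynomial ring `A = A₀[t₊,t₋;α]` is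
neither left artinian nor right artinian. -/
theorem cornerSkewLaurent_not_artinian
    {A : Type*} [Ring A] (hA : (1 : A) ≠ 0) (G : ZGrading A) (tm tp : A)
    (htm : tm ∈ G.comp 1) (htp : tp ∈ G.comp (-1)) (hunit : tm * tp = 1)
    (hpos : ∀ n : ℕ,
      (G.comp ((n : ℤ) + 1) : Set A) = {x | ∃ r ∈ G.comp 0, x = tm ^ (n + 1) * r})
    (hneg : ∀ n : ℕ,
      (G.comp (-((n : ℤ) + 1)) : Set A) = {x | ∃ r ∈ G.comp 0, x = r * tp ^ (n + 1)}) :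
    ¬ DCCOn (LeftIdealOf (⊤ : AddSubgroup A)) ∧
    ¬ DCCOn (RightIdealOf (⊤ : AddSubgroup A)) := by
  let _ : DirectSum.Decomposition G.comp := G.isInternal.chooseDecomposition
  have h1 : (1 : A) ∈ G.comp 0 := by
    rw [← hunit]
    exact G.mul_mem htm htp
  have hpow : ∀ n : ℕ, tm ^ n ≠ 0 := by
    intro n h
    have hn : tm ^ n * tp ^ n = 1 := pow_mul_pow_eq_one n hunit
    rw [h, zero_mul] at hn
    exact hA hn.symm
  have hR : ∀ i, ∀ x ∈ G.comp i, AddMonoidHom.mulRight tm x ∈ G.comp (i + 1) :=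
    fun i x hx => G.mul_mem hx htm
  have hL : ∀ i, ∀ x ∈ G.comp i, AddMonoidHom.mulLeft tm x ∈ G.comp (i + 1) :=
    fun i x hx => add_comm 1 i ▸ G.mul_mem htm hx
  constructor
  · intro h
    have hs : IsRightRegular (1 - tm) := isRightRegular_of_non_zero_divisor _ fun x hx =>
      eq_zero_of_shift_eq_self G.comp hR (by
        rw [mul_sub, mul_one, sub_eq_zero] at hx
        exact hx.symm)
    obtain ⟨a, ha⟩ := exists_mul_eq_one_of_dccOn_leftIdealOf h hs
    obtain ⟨n, hn⟩ := exists_iterate_eq_zero_of_shift G.comp hR h1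
      (x := a) (by rw [← ha, AddMonoidHom.mulRight_apply]; noncomm_ring)
    exact hpow n (by simpa [AddMonoidHom.coe_mulRight, mul_right_iterate] using hn)
  · intro h
    have hs : IsLeftRegular (1 - tm) := isLeftRegular_of_non_zero_divisor _ fun x hx =>
      eq_zero_of_shift_eq_self G.comp hL (by
        rw [sub_mul, one_mul, sub_eq_zero] at hx
        exact hx.symm)
    obtain ⟨a, ha⟩ := exists_mul_eq_one_of_dccOn_rightIdealOf h hs
    obtain ⟨n, hn⟩ := exists_iterate_eq_zero_of_shift G.comp hL h1
      (x := a) (by rw [← ha, AddMonoidHom.coe_mulLeft]; noncomm_ring)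
    exact hpow n (by simpa [AddMonoidHom.coe_mulLeft, mul_left_iterate] using hn)
end
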